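/- arXiv:math/0602224 — 5 statements merged into one kernel-verified Lean document; each statement's English description precedes it below -/
import Mathlib

section
/- Fix a field k, n ∈ ℕ, I = {0,1,…,n}; let v = (1,1,…,1) ∈ k^{n+1} and e_0,…,e_n the canonical basis of k^{n+1}, and let σ be a permutation of I. If F = {F_i : i ∈ I} and G = {G_i : i ∈ I} are compatible (I,σ)-systems, then F_0 = G_0 = Id and (F_i)_{kj} = (G_j)_{ki} for all i,j,k ∈ I. -/
open Matrix

/-- An `(I,σ)`-system: a family of invertible matrices `F_i ∈ M_{n+1}(k)` with
`F_{σ(i)} = F_iᵀ = F_i⁻¹`, `F_i v = v` (`v` the all-ones vector) and `F_i e_0 = e_i`. -/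
def IsSystem {k : Type*} [Field k] {n : ℕ} (σ : Equiv.Perm (Fin (n + 1)))
    (F : Fin (n + 1) → Matrix (Fin (n + 1)) (Fin (n + 1)) k) : Prop :=
  ∀ i, F (σ i) = (F i)ᵀ ∧ F i * (F i)ᵀ = 1 ∧ (F i)ᵀ * F i = 1 ∧
    F i *ᵥ (fun _ => (1 : k)) = (fun _ => (1 : k)) ∧
    F i *ᵥ Pi.single 0 1 = Pi.single i 1

theorem IsSystem.apply_zero {k : Type*} [Field k] {n : ℕ} {σ : Equiv.Perm (Fin (n + 1))}
    {F : Fin (n + 1) → Matrix (Fin (n + 1)) (Fin (n + 1)) k} (hF : IsSystem σ F)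
    (i m : Fin (n + 1)) : F i m 0 = (Pi.single i 1 : Fin (n + 1) → k) m := by
  rw [← (hF i).2.2.2.2, mulVec_single_one, col_apply]

/-- If `F` and `G` are compatible `(I,σ)`-systems, then `F_0 = G_0 = Id` and
`(F_i)_{kj} = (G_j)_{ki}` for all `i, j, k`. -/
theorem stmt8 (k : Type*) [Field k] (n : ℕ) (σ : Equiv.Perm (Fin (n + 1)))
    (F G : Fin (n + 1) → Matrix (Fin (n + 1)) (Fin (n + 1)) k)
    (hF : IsSystem σ F) (hG : IsSystem σ G)
    (hcomp : ∀ i j, F i * G j = G j * F i) :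
    F 0 = 1 ∧ G 0 = 1 ∧ ∀ i j m, F i m j = G j m i := by
  have key : ∀ i j m, F i m j = G j m i := fun i j m => by
    have h : (F i * G j) *ᵥ Pi.single 0 1 = (G j * F i) *ᵥ Pi.single 0 1 := by rw [hcomp]
    rw [← mulVec_mulVec, ← mulVec_mulVec, (hF i).2.2.2.2, (hG j).2.2.2.2,
      mulVec_single_one, mulVec_single_one] at h
    exact congrFun h m
  refine ⟨?_, ?_, key⟩
  · ext m j
    rw [key, hG.apply_zero, Pi.single_apply, one_apply]
  · ext m i
    rw [← key, hF.apply_zero, Pi.single_apply, one_apply]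
end

section
/- Fix a field k, n ∈ ℕ, I = {0,1,…,n}; let e_0,…,e_n be the canonical basis of k^{n+1} and σ a permutation of I. Let p_{ij}^k ∈ k (i,j,k ∈ I) be given, let · be the bilinear multiplication on k^{n+1} with e_i · e_j = Σ_{k∈I} p_{ij}^k e_k, and define matrices H_i, V_j ∈ M_{n+1}(k) by (H_i)_{kj} = p_{ij}^k = (V_j)_{ki}. Then the following are equivalent: (a) the multiplication · is associative with two-sided unit e_0, and: p_{ij}^0 = δ_{i,σ(j)} for all i,j; p_{ij}^k = p_{σ(j)σ(i)}^{σ(k)} for all i,j,k; σ(0) = 0; Σ_{k∈I} p_{ij}^k = 1 for all i,j; and e_{σ(i)} · e_i = e_0 for all i (that is, (k^{n+1}, {e_i}, p, 1, σ) is a group-like algebra with ε ≡ 1 satisfying S*id = uε̄); (b) H = {H_i : i ∈ I} and V = {V_j : j ∈ I} are compatible (I,σ)-systems and σ∘σ = id. -/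
open Matrix

/-- The bilinear multiplication on `k^{n+1}` with `e_i · e_j = Σ_m p_{ij}^m e_m`. -/
def mulP {k : Type*} [Field k] {n : ℕ} (p : Fin (n + 1) → Fin (n + 1) → Fin (n + 1) → k)
    (x y : Fin (n + 1) → k) : Fin (n + 1) → k :=
  fun m => ∑ i, ∑ j, x i * y j * p i j m

section mulP

variable {k : Type*} [Field k] {n : ℕ} (p : Fin (n + 1) → Fin (n + 1) → Fin (n + 1) → k)

theorem mulP_single_left (i : Fin (n + 1)) (x : Fin (n + 1) → k) (m : Fin (n + 1)) :
    mulP p (Pi.single i 1) x m = ∑ j, x j * p i j m := by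
  simp only [mulP]
  rw [Finset.sum_eq_single i (fun b _ hb => by simp [hb]) (by simp)]
  simp

theorem mulP_single_right (x : Fin (n + 1) → k) (j m : Fin (n + 1)) :
    mulP p x (Pi.single j 1) m = ∑ i, x i * p i j m := by
  simp only [mulP]
  refine Finset.sum_congr rfl fun i _ => ?_
  rw [Finset.sum_eq_single j (fun b _ hb => by simp [hb]) (by simp)]
  simp

theorem mulP_single_single (i j : Fin (n + 1)) :
    mulP p (Pi.single i 1) (Pi.single j 1) = p i j := by
  ext m
  rw [mulP_single_left, Finset.sum_eq_single j (fun b _ hb => by simp [hb]) (by simp)]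
  simp

theorem mulP_assoc_iff :
    (∀ x y z : Fin (n + 1) → k, mulP p (mulP p x y) z = mulP p x (mulP p y z)) ↔
      ∀ i j l m, ∑ a, p i j a * p a l m = ∑ a, p j l a * p i a m := by
  constructor
  · intro h i j l m
    have := congrFun (h (Pi.single i 1) (Pi.single j 1) (Pi.single l 1)) m
    rwa [mulP_single_single, mulP_single_single, mulP_single_left, mulP_single_right] at this
  · intro h x y z
    ext m
    have hl : mulP p (mulP p x y) z m =
        ∑ i, ∑ j, ∑ l, x i * y j * z l * ∑ a, p i j a * p a l m := by
      simp only [mulP, Finset.sum_mul, Finset.mul_sum]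
      calc _ = ∑ a, ∑ i, ∑ j, ∑ l, x i * y j * p i j a * z l * p a l m := by
            refine Finset.sum_congr rfl fun a _ => ?_
            rw [Finset.sum_comm]
            exact Finset.sum_congr rfl fun i _ => Finset.sum_comm
        _ = _ := by
            rw [Finset.sum_comm]
            refine Finset.sum_congr rfl fun i _ => ?_
            rw [Finset.sum_comm]
            refine Finset.sum_congr rfl fun j _ => ?_
            rw [Finset.sum_comm]
            exact Finset.sum_congr rfl fun l _ => Finset.sum_congr rfl fun a _ => by ring
    have hr : mulP p x (mulP p y z) m =
        ∑ i, ∑ j, ∑ l, x i * y j * z l * ∑ a, p j l a * p i a m := by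
      simp only [mulP, Finset.sum_mul, Finset.mul_sum]
      refine Finset.sum_congr rfl fun i _ => ?_
      rw [Finset.sum_comm]
      refine Finset.sum_congr rfl fun j _ => ?_
      rw [Finset.sum_comm]
      exact Finset.sum_congr rfl fun l _ => Finset.sum_congr rfl fun a _ => by ring
    rw [hl, hr]
    simp only [h]

theorem single_mulP_eq_self_iff (i : Fin (n + 1)) :
    (∀ x : Fin (n + 1) → k, mulP p (Pi.single i 1) x = x) ↔
      ∀ j m, p i j m = if m = j then 1 else 0 := by
  refine ⟨fun h j m => ?_, fun h x => ?_⟩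
  · rw [← mulP_single_single p, h, Pi.single_apply]
  · ext m
    simp [mulP_single_left, h]

theorem mulP_single_eq_self_iff (j : Fin (n + 1)) :
    (∀ x : Fin (n + 1) → k, mulP p x (Pi.single j 1) = x) ↔
      ∀ i m, p i j m = if m = i then 1 else 0 := by
  refine ⟨fun h i m => ?_, fun h x => ?_⟩
  · rw [← mulP_single_single p, h, Pi.single_apply]
  · ext m
    simp [mulP_single_right, h]

end mulP

/-- `(k^{n+1}, {e_i}, p, 1, σ)` is a group-like algebra with `ε ≡ 1` satisfying
`S * id = uε̄` if and only if `H = {H_i}` and `V = {V_j}` (where `(H_i)_{kj} = p_{ij}^k =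
(V_j)_{ki}`) are compatible `(I,σ)`-systems and `σ² = id`. -/
theorem stmt9 (k : Type*) [Field k] (n : ℕ) (σ : Equiv.Perm (Fin (n + 1)))
    (p : Fin (n + 1) → Fin (n + 1) → Fin (n + 1) → k)
    (H V : Fin (n + 1) → Matrix (Fin (n + 1)) (Fin (n + 1)) k)
    (hH : ∀ i m j, H i m j = p i j m) (hV : ∀ j m i, V j m i = p i j m) :
    ((∀ x y z : Fin (n + 1) → k, mulP p (mulP p x y) z = mulP p x (mulP p y z)) ∧
      (∀ x : Fin (n + 1) → k, mulP p (Pi.single 0 1) x = x) ∧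
      (∀ x : Fin (n + 1) → k, mulP p x (Pi.single 0 1) = x) ∧
      (∀ i j, p i j 0 = if i = σ j then 1 else 0) ∧
      (∀ i j m, p i j m = p (σ j) (σ i) (σ m)) ∧
      σ 0 = 0 ∧
      (∀ i j, ∑ m, p i j m = 1) ∧
      (∀ i, mulP p (Pi.single (σ i) 1) (Pi.single i 1) = Pi.single 0 1)) ↔
    (IsSystem σ H ∧ IsSystem σ V ∧ (∀ i j, H i * V j = V j * H i) ∧ ∀ i, σ (σ i) = i) := by
  have hcomm : (∀ i j, H i * V j = V j * H i) ↔
      ∀ i j l m, ∑ a, p i j a * p a l m = ∑ a, p j l a * p i a m := by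
    have entry (i j l m) : (H i * V l) m j = (V l * H i) m j ↔
        ∑ a, p i j a * p a l m = ∑ a, p j l a * p i a m := by
      simp only [Matrix.mul_apply, hH, hV]
      rw [eq_comm]
      simp only [mul_comm]
    exact ⟨fun h i j l m => (entry i j l m).1 (by rw [h]),
      fun h i l => Matrix.ext fun m j => (entry i j l m).2 (h i j l m)⟩
  rw [mulP_assoc_iff, single_mulP_eq_self_iff, mulP_single_eq_self_iff, ← hcomm]
  simp only [mulP_single_single]
  constructor
  · rintro ⟨hc, h0l, h0r, hp0, hanti, hσ0, hsum, hinv⟩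
    have ha := hcomm.1 hc
    have hσ (j) : σ (σ j) = j := by
      have h := hanti (σ j) j 0
      rw [hσ0, hp0, hp0, if_pos rfl] at h
      by_contra hne
      rw [if_neg fun h' => hne (σ.injective h').symm] at h
      exact one_ne_zero h
    have hcyc (a b c) : p a b (σ c) = p b c (σ a) := by
      have h := ha a b c 0
      have e (x) : (a = σ x) ↔ (x = σ a) :=
        ⟨fun h => by rw [h, hσ], fun h => by rw [h, hσ]⟩
      simpa [hp0, e] using h
    have hHt (i j m) : p (σ i) j m = p i m j := by
      rw [← hσ m, hcyc, hσ, hσ, hanti, hσ, ← hcyc, hσ]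
    have hVt (i j m) : p i (σ j) m = p m j i := by
      have h := hanti i (σ j) m
      rw [hσ] at h
      rw [h, ← hHt, hanti, hσ, hσ, hσ]
    have hHT (i) : H (σ i) = (H i)ᵀ := by
      ext m j
      rw [Matrix.transpose_apply, hH, hH, hHt]
    have hVT (j) : V (σ j) = (V j)ᵀ := by
      ext m i
      rw [Matrix.transpose_apply, hV, hV, hVt]
    have hHmul (i) : (H i)ᵀ * H i = 1 := by
      ext m l
      rw [← hHT, Matrix.mul_apply, Matrix.one_apply, ← h0l]
      have h := ha (σ i) i l m
      simp only [hinv] at h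
      simpa [hH, Pi.single_apply, mul_comm] using h.symm
    have hVmul (j) : V j * (V j)ᵀ = 1 := by
      ext m i
      rw [← hVT, Matrix.mul_apply, Matrix.one_apply, ← h0r]
      have h := ha i (σ j) j m
      simp only [hinv] at h
      simpa [hV, Pi.single_apply, mul_comm] using h
    refine ⟨fun i => ⟨hHT i, mul_eq_one_comm.1 (hHmul i), hHmul i, ?_, ?_⟩,
      fun j => ⟨hVT j, hVmul j, mul_eq_one_comm.1 (hVmul j), ?_, ?_⟩, hc, hσ⟩
    · ext m
      simpa [Matrix.mulVec, dotProduct, hH, hHt] using hsum (σ i) m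
    · ext m
      simp [hH, h0r, Pi.single_apply]
    · ext m
      simpa [Matrix.mulVec, dotProduct, hV, hVt] using hsum m (σ j)
    · ext m
      simp [hV, h0l, Pi.single_apply]
  · rintro ⟨hHs, hVs, hc, hσ⟩
    have hHt (i j m) : p (σ i) j m = p i m j := by
      rw [← hH, ← hH, (hHs i).1, Matrix.transpose_apply]
    have hVt (i j m) : p i (σ j) m = p m j i := by
      rw [← hV, ← hV, (hVs j).1, Matrix.transpose_apply]
    have h0r (i m) : p i 0 m = if m = i then 1 else 0 := by
      simpa [hH, Pi.single_apply] using congrFun (hHs i).2.2.2.2 m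
    have h0l (j m) : p 0 j m = if m = j then 1 else 0 := by
      simpa [hV, Pi.single_apply] using congrFun (hVs j).2.2.2.2 m
    have hσ0 : σ 0 = 0 := by
      have h := hHt 0 0 0
      rw [h0r, h0r, if_pos rfl] at h
      by_contra hne
      rw [if_neg (Ne.symm hne)] at h
      exact zero_ne_one h
    refine ⟨hc, h0l, h0r, fun i j => ?_, fun i j m => ?_, hσ0, fun i j => ?_, fun i => ?_⟩
    · rw [← hσ i, hHt, h0r]
      simp only [σ.injective.eq_iff, eq_comm]
    · rw [hHt, hVt, hHt]
    · simpa [Matrix.mulVec, dotProduct, hH, hHt] using congrFun (hHs (σ i)).2.2.2.1 j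
    · have h : H (σ i) *ᵥ Pi.single i 1 = Pi.single 0 1 := by
        rw [← (hHs i).2.2.2.2, Matrix.mulVec_mulVec, (hHs i).1, (hHs i).2.2.1,
          Matrix.one_mulVec]
      rw [← h]
      ext m
      simp [hH]
end

section
/- Let k be a field with char k ≠ 2, n ∈ ℕ, I = {0,1,…,n}, and let {H_i : i ∈ I} be a self-compatible (I,id)-system in M_{n+1}(k). Then there exists an invertible matrix P ∈ M_{n+1}(k) such that: all entries of P lie in {1,-1}; the first row and the first column of P consist entirely of 1's; P Pᵀ = (n+1)·Id; and for every i ∈ I, H_i = P D_i P⁻¹, where D_i is the diagonal matrix whose diagonal is the i-th row of P, i.e. (D_i)_{rs} = δ_{r,s} P_{ir}. In particular P is a Hadamard matrix whose columns form a common basis of eigenvectors for all the H_i. -/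
open Matrix

/-- A self-compatible `(I,id)`-system: a family of matrices `H_i ∈ M_{n+1}(k)` with
`H_i = H_iᵀ = H_i⁻¹`, `H_i H_j = H_j H_i`, `H_i v = v` (`v` the all-ones vector) and
`H_i e_0 = e_i`. -/
def IsSelfCompatSystem {k : Type*} [Field k] {n : ℕ}
    (H : Fin (n + 1) → Matrix (Fin (n + 1)) (Fin (n + 1)) k) : Prop :=
  ∀ i j, H i = (H i)ᵀ ∧ H i * H i = 1 ∧ H i * H j = H j * H i ∧
    H i *ᵥ (fun _ => (1 : k)) = (fun _ => (1 : k)) ∧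
    H i *ᵥ Pi.single 0 1 = Pi.single i 1

/-- Commuting involutions are simultaneously diagonalizable when `2 ≠ 0`. -/
theorem mem_span_common_eigenvectors {k ι m : Type*} [Field k] [Fintype m] [DecidableEq m]
    (hchar : (2 : k) ≠ 0) (H : ι → Matrix m m k) (hinv : ∀ i, H i * H i = 1)
    (hcomm : ∀ i j, H i * H j = H j * H i) (t : Finset ι) (w : m → k) :
    w ∈ Submodule.span k
      {u : m → k | ∀ i ∈ t, ∃ ε : k, (ε = 1 ∨ ε = -1) ∧ H i *ᵥ u = ε • u} := by
  classical
  induction t using Finset.induction_on with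
  | empty => exact Submodule.subset_span (by simp)
  | insert j t _ ih =>
    refine Submodule.span_le.2 (fun u hu => ?_) ih
    have hjj : H j *ᵥ (H j *ᵥ u) = u := by rw [mulVec_mulVec, hinv, one_mulVec]
    have key : ∀ δ : k, (δ = 1 ∨ δ = -1) → u + δ • H j *ᵥ u ∈ Submodule.span k
        {u : m → k | ∀ i ∈ insert j t, ∃ ε : k, (ε = 1 ∨ ε = -1) ∧ H i *ᵥ u = ε • u} := by
      intro δ hδ
      refine Submodule.subset_span fun i hi => ?_
      rcases Finset.mem_insert.1 hi with rfl | hi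
      · refine ⟨δ, hδ, ?_⟩
        have hδδ : δ * δ = 1 := by rcases hδ with rfl | rfl <;> ring
        rw [mulVec_add, mulVec_smul, hjj, smul_add, smul_smul, hδδ, one_smul, add_comm]
      · obtain ⟨ε, hε, h⟩ := hu i hi
        refine ⟨ε, hε, ?_⟩
        rw [mulVec_add, mulVec_smul, mulVec_mulVec, hcomm, ← mulVec_mulVec, h, mulVec_smul,
          smul_add, smul_comm]
    have hsum : u = (2 : k)⁻¹ • ((u + (1 : k) • H j *ᵥ u) + (u + (-1 : k) • H j *ᵥ u)) := by
      ext x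
      simp only [Pi.smul_apply, Pi.add_apply, smul_eq_mul]
      field_simp
      ring
    rw [SetLike.mem_coe, hsum]
    exact Submodule.smul_mem _ _ (Submodule.add_mem _ (key 1 (.inl rfl)) (key (-1) (.inr rfl)))

/-- The common eigenvectors of the family `H`, normalized to have entry `1` at `0`; the entries of
such a vector are its eigenvalues. -/
def normalizedEigenvectors {k : Type*} [Field k] {n : ℕ}
    (H : Fin (n + 1) → Matrix (Fin (n + 1)) (Fin (n + 1)) k) : Set (Fin (n + 1) → k) :=
  {s | s 0 = 1 ∧ (∀ i, s i = 1 ∨ s i = -1) ∧ ∀ i, H i *ᵥ s = s i • s}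

section

variable {k : Type*} [Field k] {n : ℕ} {H : Fin (n + 1) → Matrix (Fin (n + 1)) (Fin (n + 1)) k}

theorem IsSelfCompatSystem.mulVec_dotProduct (hH : IsSelfCompatSystem H) (i : Fin (n + 1))
    (u w : Fin (n + 1) → k) : (H i *ᵥ u) ⬝ᵥ w = u ⬝ᵥ (H i *ᵥ w) := by
  conv_rhs => rw [(hH i i).1, mulVec_transpose, dotProduct_comm, ← dotProduct_mulVec,
    dotProduct_comm]

theorem IsSelfCompatSystem.mulVec_apply_zero (hH : IsSelfCompatSystem H) (i : Fin (n + 1))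
    (u : Fin (n + 1) → k) : (H i *ᵥ u) 0 = u i := by
  have h := hH.mulVec_dotProduct i u (Pi.single 0 1)
  rwa [(hH i i).2.2.2.2, dotProduct_single_one, dotProduct_single_one] at h

theorem IsSelfCompatSystem.span_normalizedEigenvectors (hH : IsSelfCompatSystem H)
    (hchar : (2 : k) ≠ 0) : Submodule.span k (normalizedEigenvectors H) = ⊤ := by
  refine eq_top_iff.2 fun w _ => Submodule.span_le.2 (fun u hu => ?_)
    (mem_span_common_eigenvectors hchar H (fun i => (hH i i).2.1) (fun i j => (hH i j).2.2.1)
      Finset.univ w)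
  choose ε hε hu using fun i => hu i (Finset.mem_univ i)
  have hval : ∀ i, u i = ε i * u 0 := fun i => by
    rw [← hH.mulVec_apply_zero i u, hu, Pi.smul_apply, smul_eq_mul]
  by_cases h0 : u 0 = 0
  · have : u = 0 := by ext i; simp [hval i, h0]
    rw [this]
    exact Submodule.zero_mem _
  · have hus : u = u 0 • ε := by ext i; rw [hval i, Pi.smul_apply, smul_eq_mul, mul_comm]
    rw [SetLike.mem_coe, hus]
    refine Submodule.smul_mem _ _ (Submodule.subset_span ⟨?_, hε, fun i => ?_⟩)
    · exact mul_right_cancel₀ h0 (by rw [← hval, one_mul])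
    · have h := hu i
      rw [hus, mulVec_smul, smul_comm] at h
      exact smul_right_injective _ h0 h

theorem IsSelfCompatSystem.dotProduct_eq_zero (hH : IsSelfCompatSystem H)
    {s t : Fin (n + 1) → k} (hs : s ∈ normalizedEigenvectors H)
    (ht : t ∈ normalizedEigenvectors H) (hst : s ≠ t) : s ⬝ᵥ t = 0 := by
  obtain ⟨i, hi⟩ := Function.ne_iff.1 hst
  have h := hH.mulVec_dotProduct i s t
  rw [hs.2.2, ht.2.2, smul_dotProduct, dotProduct_smul, smul_eq_mul, smul_eq_mul] at h
  by_contra h0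
  exact hi (mul_right_cancel₀ h0 h)

theorem dotProduct_self_of_mem_normalizedEigenvectors {s : Fin (n + 1) → k}
    (hs : s ∈ normalizedEigenvectors H) : s ⬝ᵥ s = (n : k) + 1 := by
  have h : ∀ i, s i * s i = 1 := fun i => by rcases hs.2.1 i with h | h <;> simp [h]
  simp [dotProduct, h]

theorem IsSelfCompatSystem.natCast_add_one_ne_zero (hH : IsSelfCompatSystem H)
    (hchar : (2 : k) ≠ 0) : (n : k) + 1 ≠ 0 := by
  intro h0
  have hone : (fun _ => 1 : Fin (n + 1) → k) ∈ normalizedEigenvectors H :=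
    ⟨rfl, fun _ => .inl rfl, fun i => by rw [(hH i i).2.2.2.1, one_smul]⟩
  have hperp : ∀ w : Fin (n + 1) → k, (fun _ => 1 : Fin (n + 1) → k) ⬝ᵥ w = 0 := by
    intro w
    have hw : w ∈ Submodule.span k (normalizedEigenvectors H) := by
      rw [hH.span_normalizedEigenvectors hchar]; trivial
    induction hw using Submodule.span_induction with
    | mem t ht =>
      by_cases h : (fun _ => 1 : Fin (n + 1) → k) = t
      · subst h; rw [dotProduct_self_of_mem_normalizedEigenvectors ht, h0]
      · exact hH.dotProduct_eq_zero hone ht h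
    | zero => exact dotProduct_zero _
    | add x y _ _ hx hy => rw [dotProduct_add, hx, hy, add_zero]
    | smul a x _ hx => rw [dotProduct_smul, hx, smul_zero]
  simpa using hperp (Pi.single 0 1)

theorem IsSelfCompatSystem.linearIndependent_normalizedEigenvectors (hH : IsSelfCompatSystem H)
    (hchar : (2 : k) ≠ 0) :
    LinearIndependent k ((↑) : normalizedEigenvectors H → Fin (n + 1) → k) := by
  rw [linearIndependent_iff']
  intro F c hc s hsF
  have h := congrArg ((s : Fin (n + 1) → k) ⬝ᵥ ·) hc
  simp only [dotProduct_sum, dotProduct_smul, dotProduct_zero] at h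
  rw [Finset.sum_eq_single_of_mem s hsF fun t _ hts => by
      rw [hH.dotProduct_eq_zero s.2 t.2 fun h => hts (Subtype.ext h.symm), smul_zero],
    dotProduct_self_of_mem_normalizedEigenvectors s.2, smul_eq_mul] at h
  exact (mul_eq_zero.1 h).resolve_right (hH.natCast_add_one_ne_zero hchar)

end

/-- If `char k ≠ 2`, the matrices of a self-compatible `(I,id)`-system admit a
common basis of eigenvectors forming a Hadamard matrix `P`: there is an invertible matrix `P`
with entries in `{1,-1}`, first row and column all `1`, `P Pᵀ = (n+1)·Id`, and
`H_i = P D_i P⁻¹` where `D_i` is the diagonal matrix whose diagonal is the `i`-th row of `P`. -/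
theorem stmt12 (k : Type*) [Field k] (hchar : (2 : k) ≠ 0) (n : ℕ)
    (H : Fin (n + 1) → Matrix (Fin (n + 1)) (Fin (n + 1)) k)
    (hH : IsSelfCompatSystem H) :
    ∃ P : Matrix (Fin (n + 1)) (Fin (n + 1)) k, IsUnit P ∧
      (∀ i j, P i j = 1 ∨ P i j = -1) ∧
      (∀ j, P 0 j = 1) ∧ (∀ i, P i 0 = 1) ∧
      P * Pᵀ = ((n : k) + 1) • 1 ∧
      ∀ i, H i = P * Matrix.diagonal (P i) * P⁻¹ := by
  let b := Module.Basis.mk (hH.linearIndependent_normalizedEigenvectors hchar)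
    (by rw [Subtype.range_coe, hH.span_normalizedEigenvectors hchar])
  let e₀ : Fin (n + 1) ≃ normalizedEigenvectors H := (Pi.basisFun k (Fin (n + 1))).indexEquiv b
  let v : normalizedEigenvectors H := ⟨fun _ => 1, rfl, fun _ => .inl rfl, fun i => by
    rw [(hH i i).2.2.2.1, one_smul]⟩
  obtain ⟨e, he⟩ : ∃ e : Fin (n + 1) ≃ normalizedEigenvectors H, e 0 = v :=
    ⟨(Equiv.swap 0 (e₀.symm v)).trans e₀, by simp⟩
  have hn := hH.natCast_add_one_ne_zero hchar
  let P : Matrix (Fin (n + 1)) (Fin (n + 1)) k := Matrix.of fun i j => (e j).1 i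
  have hPtP : Pᵀ * P = ((n : k) + 1) • 1 := by
    ext j l
    change (e j).1 ⬝ᵥ (e l).1 = _
    by_cases h : j = l
    · subst h
      rw [dotProduct_self_of_mem_normalizedEigenvectors (e j).2]
      simp
    · rw [hH.dotProduct_eq_zero (e j).2 (e l).2 fun h' => h (e.injective (Subtype.ext h'))]
      simp [h]
  have hleft : (((n : k) + 1)⁻¹ • Pᵀ) * P = 1 := by
    rw [Matrix.smul_mul, hPtP, smul_smul, inv_mul_cancel₀ hn, one_smul]
  have hright := mul_eq_one_comm.1 hleft
  have hunit : IsUnit P := IsUnit.of_mul_eq_one _ hright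
  refine ⟨P, hunit, fun i j => (e j).2.2.1 i, fun j => (e j).2.1, fun i => ?_, ?_, fun i => ?_⟩
  · change (e 0).1 i = 1
    rw [he]
  · rw [Matrix.mul_smul] at hright
    rw [← hright, smul_smul, mul_inv_cancel₀ hn, one_smul]
  · have hHP : H i * P = P * Matrix.diagonal (P i) := by
      ext r j
      rw [mul_diagonal, mul_comm]
      exact congrFun ((e j).2.2.2 i) r
    rw [← hHP, mul_assoc, mul_nonsing_inv _ ((isUnit_iff_isUnit_det P).1 hunit), mul_one]
end

section
/- Let k be a field, n ∈ ℕ, I = {0,1,…,n}, and let {H_i : i ∈ I} be a self-compatible (I,id)-system in M_{n+1}(k). Let w = (w_0, w_1, …, w_n) ∈ k^{n+1} be a nonzero common eigenvector of all the H_i, i.e. for each i ∈ I there is λ_i ∈ k with H_i w = λ_i w. Then w_0 ≠ 0, and for every i ∈ I one has w_i = λ_i w_0, λ_i² = 1 (so w_i = ± w_0), and H_i w = (w_i w_0⁻¹) w. -/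
open Matrix

/-- A common eigenvector of a self-compatible system has `w_i = λ_i w_0`, since
`w_i = ⟨H_i e_0, w⟩ = ⟨e_0, H_i w⟩`. -/
theorem IsSelfCompatSystem.apply_eq_mul {k : Type*} [Field k] {n : ℕ}
    {H : Fin (n + 1) → Matrix (Fin (n + 1)) (Fin (n + 1)) k} (hH : IsSelfCompatSystem H)
    {w : Fin (n + 1) → k} {i : Fin (n + 1)} {c : k} (h : H i *ᵥ w = c • w) :
    w i = c * w 0 := by
  obtain ⟨hsymm, -, -, -, hcol⟩ := hH i i
  calc
    w i = Pi.single i 1 ⬝ᵥ w := by simp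
    _ = (H i *ᵥ Pi.single 0 1) ⬝ᵥ w := by rw [hcol]
    _ = Pi.single 0 1 ⬝ᵥ (H i *ᵥ w) := by
      rw [Matrix.dotProduct_mulVec, ← Matrix.mulVec_transpose, ← hsymm]
    _ = c * w 0 := by simp [h]

/-- An eigenvalue of an involutive matrix squares to one. -/
theorem Matrix.sq_eq_one_of_mulVec_eq_smul {k ι : Type*} [Field k] [Fintype ι] [DecidableEq ι]
    {A : Matrix ι ι k} (hA : A * A = 1) {w : ι → k} (hw : w ≠ 0) {c : k}
    (h : A *ᵥ w = c • w) : c ^ 2 = 1 := by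
  have hsq : c ^ 2 • w = (1 : k) • w := by
    rw [pow_two, mul_smul, ← h, ← Matrix.mulVec_smul, ← h, Matrix.mulVec_mulVec, hA,
      Matrix.one_mulVec, one_smul]
  exact smul_left_injective k hw hsq

/-- If `w` is a nonzero common eigenvector of all matrices of a self-compatible
`(I,id)`-system, with `H_i w = λ_i w`, then `w_0 ≠ 0` and for every `i`: `w_i = λ_i w_0`,
`λ_i² = 1` (so `w_i = ± w_0`), and `H_i w = (w_i w_0⁻¹) w`. -/
theorem stmt13 (k : Type*) [Field k] (n : ℕ)
    (H : Fin (n + 1) → Matrix (Fin (n + 1)) (Fin (n + 1)) k)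
    (hH : IsSelfCompatSystem H)
    (w : Fin (n + 1) → k) (hw : w ≠ 0)
    (lam : Fin (n + 1) → k) (heig : ∀ i, H i *ᵥ w = lam i • w) :
    w 0 ≠ 0 ∧ ∀ i, w i = lam i * w 0 ∧ (lam i) ^ 2 = 1 ∧
      H i *ᵥ w = (w i * (w 0)⁻¹) • w := by
  have happly : ∀ i, w i = lam i * w 0 := fun i => hH.apply_eq_mul (heig i)
  have hw0 : w 0 ≠ 0 := fun h0 => hw (funext fun i => by rw [happly i, h0, mul_zero, Pi.zero_apply])
  refine ⟨hw0, fun i => ⟨happly i, ?_, ?_⟩⟩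
  · exact Matrix.sq_eq_one_of_mulVec_eq_smul (hH i i).2.1 hw (heig i)
  · rw [happly i, mul_inv_cancel_right₀ hw0, heig i]
end

section
/- Let k be a field, n ∈ ℕ with (n+1 : k) ≠ 0 (char k does not divide n+1), I = {0,1,…,n}, and let P ∈ M_{n+1}(k) be a Hadamard matrix of size n+1. For each i ∈ I let D_i be the diagonal matrix whose diagonal is the i-th row of P ((D_i)_{rs} = δ_{r,s} P_{ir}), and set H_i = (n+1)⁻¹ P D_i Pᵀ (note P is invertible with P⁻¹ = (n+1)⁻¹ Pᵀ, so H_i = P D_i P⁻¹). Then {H_i : i ∈ I} is a self-compatible (I,id)-system, and the columns of P are common eigenvectors of all the H_i. -/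
open Matrix

/-- If `char k` does not divide `n+1` and `P` is a Hadamard matrix of size `n+1`,
then the matrices `H_i = (n+1)⁻¹ P D_i Pᵀ` (where `D_i` is the diagonal matrix whose diagonal
is the `i`-th row of `P`) form a self-compatible `(I,id)`-system, and the columns of `P` are
common eigenvectors of all the `H_i`. -/
theorem stmt14 (k : Type*) [Field k] (n : ℕ) (hn : ((n : k) + 1) ≠ 0)
    (P : Matrix (Fin (n + 1)) (Fin (n + 1)) k)
    (hPpm : ∀ i j, P i j = 1 ∨ P i j = -1)
    (hProw : ∀ j, P 0 j = 1) (hPcol : ∀ i, P i 0 = 1)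
    (hPorth : P * Pᵀ = ((n : k) + 1) • 1)
    (H : Fin (n + 1) → Matrix (Fin (n + 1)) (Fin (n + 1)) k)
    (hH : ∀ i, H i = ((n : k) + 1)⁻¹ • (P * Matrix.diagonal (P i) * Pᵀ)) :
    IsSelfCompatSystem H ∧
      ∀ i j, ∃ c : k, H i *ᵥ (fun r => P r j) = c • (fun r => P r j) := by
  have hPQ : P * (((n : k) + 1)⁻¹ • Pᵀ) = 1 := by
    rw [Matrix.mul_smul, hPorth, smul_smul, inv_mul_cancel₀ hn, one_smul]
  have hQP : (((n : k) + 1)⁻¹ • Pᵀ) * P = 1 := mul_eq_one_comm.mp hPQ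
  have hconj (i) : H i = P * diagonal (P i) * (((n : k) + 1)⁻¹ • Pᵀ) := by
    rw [hH, Matrix.mul_smul]
  have hmul (i j) :
      H i * H j = P * (diagonal (P i) * diagonal (P j)) * (((n : k) + 1)⁻¹ • Pᵀ) := by
    rw [hconj, hconj]
    generalize ((n : k) + 1)⁻¹ • Pᵀ = Q at hQP
    calc P * diagonal (P i) * Q * (P * diagonal (P j) * Q)
        = P * diagonal (P i) * (Q * P) * diagonal (P j) * Q := by simp only [Matrix.mul_assoc]
      _ = _ := by rw [hQP, Matrix.mul_one, Matrix.mul_assoc P]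
  have heig (i j) : H i *ᵥ P.col j = P i j • P.col j := by
    rw [← mulVec_single_one, hconj, mulVec_mulVec, Matrix.mul_assoc, hQP, Matrix.mul_one,
      ← mulVec_mulVec, diagonal_mulVec_single, ← smul_eq_mul, Pi.single_smul, mulVec_smul]
  refine ⟨fun i j => ⟨?_, ?_, ?_, ?_, ?_⟩, fun i j => ⟨P i j, heig i j⟩⟩
  · simp [hH, transpose_mul, Matrix.mul_assoc]
  · have hsq : diagonal (P i) * diagonal (P i) = 1 := by
      rw [diagonal_mul_diagonal, ← diagonal_one]
      congr 1
      funext r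
      rcases hPpm i r with h | h <;> simp [h]
    rw [hmul, hsq, Matrix.mul_one, hPQ]
  · rw [hmul, hmul, (commute_diagonal (P i) (P j)).eq]
  · have hcol : P.col 0 = fun _ => 1 := funext hPcol
    simpa [hcol, hPcol] using heig i 0
  · have hrow : Pᵀ *ᵥ Pi.single 0 1 = fun _ => 1 := by
      rw [mulVec_single_one]
      exact funext hProw
    have hdiag : diagonal (P i) *ᵥ (fun _ => 1) = Pᵀ *ᵥ Pi.single i 1 := by
      rw [mulVec_single_one]
      funext r
      simp [mulVec_diagonal]
    rw [hH, smul_mulVec, ← mulVec_mulVec, hrow, ← mulVec_mulVec, hdiag, mulVec_mulVec, hPorth,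
      smul_mulVec, one_mulVec, smul_smul, inv_mul_cancel₀ hn, one_smul]
end
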